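/- Completeness of bidirectional typing for CCω: if Γ ⊢ t : T, then there exists a term T' such that Γ ⊢ t ▹ T' and T' ≡ T. -/

import Mathlib

/-! Formalization of CCω (terms, reduction, conversion, undirected and
bidirectional typing, cumulativity) using de Bruijn indices, following
Lennon-Bertrand, "Complete Bidirectional Typing for the Calculus of
Inductive Constructions". -/

namespace CComega

/-- Terms of CCω: `t ::= x | □_i | Πx:t.t | λx:t.t | t t`,
with variables as de Bruijn indices. -/
inductive Tm : Type
  | var : ℕ → Tm
  | sort : ℕ → Tm
  | pi : Tm → Tm → Tm
  | lam : Tm → Tm → Tm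
  | app : Tm → Tm → Tm
deriving DecidableEq

/-- `lift n k t` shifts by `n` the de Bruijn indices of `t` that are ≥ `k`. -/
def lift (n k : ℕ) : Tm → Tm
  | .var i => if i < k then .var i else .var (i + n)
  | .sort i => .sort i
  | .pi A B => .pi (lift n k A) (lift n (k + 1) B)
  | .lam A t => .lam (lift n k A) (lift n (k + 1) t)
  | .app t u => .app (lift n k t) (lift n k u)

/-- `subst u k t` is the capture-avoiding substitution `t[u/k]` of `u`
for de Bruijn index `k` in `t`. -/
def subst (u : Tm) (k : ℕ) : Tm → Tm
  | .var i => if i < k then .var i else if i = k then lift k 0 u else .var (i - 1)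
  | .sort i => .sort i
  | .pi A B => .pi (subst u k A) (subst u (k + 1) B)
  | .lam A t => .lam (subst u k A) (subst u (k + 1) t)
  | .app t v => .app (subst u k t) (subst u k v)

/-- One-step reduction `t → t'`: the least congruence such that
`(λx:A.t) u → t[u/x]`. -/
inductive Red : Tm → Tm → Prop
  | beta (A t u : Tm) : Red (.app (.lam A t) u) (subst u 0 t)
  | piDom {A A'} (B : Tm) : Red A A' → Red (.pi A B) (.pi A' B)
  | piCod (A : Tm) {B B'} : Red B B' → Red (.pi A B) (.pi A B')
  | lamDom {A A'} (t : Tm) : Red A A' → Red (.lam A t) (.lam A' t)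
  | lamBody (A : Tm) {t t'} : Red t t' → Red (.lam A t) (.lam A t')
  | appFun {t t'} (u : Tm) : Red t t' → Red (.app t u) (.app t' u)
  | appArg (t : Tm) {u u'} : Red u u' → Red (.app t u) (.app t u')

/-- Multi-step reduction `t ↠ t'`: reflexive-transitive closure of `→`. -/
def Reds : Tm → Tm → Prop := Relation.ReflTransGen Red

/-- Conversion `t ≡ u`: symmetric, reflexive, transitive closure of `→`. -/
def Conv : Tm → Tm → Prop := Relation.EqvGen Red

/-- Contexts are lists of (de Bruijn) declarations, most recent first. -/
abbrev Ctx := List Tm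

mutual
/-- Context well-formedness `⊢ Γ`. -/
inductive WfCtx : Ctx → Prop
  | nil : WfCtx []
  | cons {Γ A i} : WfCtx Γ → Typed Γ A (.sort i) → WfCtx (A :: Γ)

/-- Undirected typing `Γ ⊢ t : T`. -/
inductive Typed : Ctx → Tm → Tm → Prop
  | sort {Γ i} : WfCtx Γ → Typed Γ (.sort i) (.sort (i + 1))
  | var {Γ n A} : WfCtx Γ → Γ[n]? = some A → Typed Γ (.var n) (lift (n + 1) 0 A)
  | pi {Γ A B i j} : Typed Γ A (.sort i) → Typed (A :: Γ) B (.sort j) →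
      Typed Γ (.pi A B) (.sort (max i j))
  | lam {Γ A B t i} : Typed Γ (.pi A B) (.sort i) → Typed (A :: Γ) t B →
      Typed Γ (.lam A t) (.pi A B)
  | app {Γ t u A B} : Typed Γ t (.pi A B) → Typed Γ u A →
      Typed Γ (.app t u) (subst u 0 B)
  | conv {Γ t A B i} : Typed Γ t A → Typed Γ B (.sort i) → Conv A B →
      Typed Γ t B
end

mutual
/-- Bidirectional inference `Γ ⊢ t ▹ T`. -/
inductive Infer : Ctx → Tm → Tm → Prop
  | sort {Γ i} : Infer Γ (.sort i) (.sort (i + 1))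
  | var {Γ n A} : Γ[n]? = some A → Infer Γ (.var n) (lift (n + 1) 0 A)
  | pi {Γ A B i j} : InferSort Γ A (.sort i) → InferSort (A :: Γ) B (.sort j) →
      Infer Γ (.pi A B) (.sort (max i j))
  | lam {Γ A t B i} : InferSort Γ A (.sort i) → Infer (A :: Γ) t B →
      Infer Γ (.lam A t) (.pi A B)
  | app {Γ t u A B} : InferPi Γ t (.pi A B) → Check Γ u A →
      Infer Γ (.app t u) (subst u 0 B)

/-- Bidirectional checking `Γ ⊢ t ◃ T`. -/
inductive Check : Ctx → Tm → Tm → Prop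
  | check {Γ t T T'} : Infer Γ t T' → Conv T' T → Check Γ t T

/-- Constrained inference `Γ ⊢ t ▹_□ T` (the output is a universe). -/
inductive InferSort : Ctx → Tm → Tm → Prop
  | inferSort {Γ t T i} : Infer Γ t T → Reds T (.sort i) → InferSort Γ t (.sort i)

/-- Constrained inference `Γ ⊢ t ▹_Π T` (the output is a product type). -/
inductive InferPi : Ctx → Tm → Tm → Prop
  | inferPi {Γ t T A B} : Infer Γ t T → Reds T (.pi A B) → InferPi Γ t (.pi A B)
end

/-- Weak-head reduction `t ⇝ t'`: reduction only at the head. -/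
inductive WhRed : Tm → Tm → Prop
  | beta (A t u : Tm) : WhRed (.app (.lam A t) u) (subst u 0 t)
  | appFun {t t'} (u : Tm) : WhRed t t' → WhRed (.app t u) (.app t' u)

/-- Multi-step weak-head reduction `t ⇝* t'`. -/
def WhReds : Tm → Tm → Prop := Relation.ReflTransGen WhRed

mutual
/-- Weak-head bidirectional inference: as `Infer`, but constrained inference
uses weak-head reduction. -/
inductive InferW : Ctx → Tm → Tm → Prop
  | sort {Γ i} : InferW Γ (.sort i) (.sort (i + 1))
  | var {Γ n A} : Γ[n]? = some A → InferW Γ (.var n) (lift (n + 1) 0 A)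
  | pi {Γ A B i j} : InferSortW Γ A (.sort i) → InferSortW (A :: Γ) B (.sort j) →
      InferW Γ (.pi A B) (.sort (max i j))
  | lam {Γ A t B i} : InferSortW Γ A (.sort i) → InferW (A :: Γ) t B →
      InferW Γ (.lam A t) (.pi A B)
  | app {Γ t u A B} : InferPiW Γ t (.pi A B) → CheckW Γ u A →
      InferW Γ (.app t u) (subst u 0 B)

/-- Weak-head bidirectional checking. -/
inductive CheckW : Ctx → Tm → Tm → Prop
  | check {Γ t T T'} : InferW Γ t T' → Conv T' T → CheckW Γ t T

/-- Weak-head constrained inference `Γ ⊢ t ▹_□ T`. -/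
inductive InferSortW : Ctx → Tm → Tm → Prop
  | inferSort {Γ t T i} : InferW Γ t T → WhReds T (.sort i) →
      InferSortW Γ t (.sort i)

/-- Weak-head constrained inference `Γ ⊢ t ▹_Π T`. -/
inductive InferPiW : Ctx → Tm → Tm → Prop
  | inferPi {Γ t T A B} : InferW Γ t T → WhReds T (.pi A B) →
      InferPiW Γ t (.pi A B)
end

/-- Cumulativity `t ≼ u`: the least transitive relation containing conversion
such that `□_i ≼ □_j` whenever `i ≤ j` and `Πx:A.B ≼ Πx:A'.B'` whenever
`A ≡ A'` and `B ≼ B'`. -/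
inductive Cum : Tm → Tm → Prop
  | ofConv {t u} : Conv t u → Cum t u
  | sort {i j : ℕ} : i ≤ j → Cum (.sort i) (.sort j)
  | pi {A A' B B'} : Conv A A' → Cum B B' → Cum (.pi A B) (.pi A' B')
  | trans {t u v} : Cum t u → Cum u v → Cum t v

mutual
/-- Context well-formedness for the cumulative undirected system. -/
inductive WfCtxC : Ctx → Prop
  | nil : WfCtxC []
  | cons {Γ A i} : WfCtxC Γ → TypedC Γ A (.sort i) → WfCtxC (A :: Γ)

/-- Cumulative undirected typing `Γ ⊢ t : T`: as `Typed`, with the conversion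
rule replaced by cumulativity. -/
inductive TypedC : Ctx → Tm → Tm → Prop
  | sort {Γ i} : WfCtxC Γ → TypedC Γ (.sort i) (.sort (i + 1))
  | var {Γ n A} : WfCtxC Γ → Γ[n]? = some A → TypedC Γ (.var n) (lift (n + 1) 0 A)
  | pi {Γ A B i j} : TypedC Γ A (.sort i) → TypedC (A :: Γ) B (.sort j) →
      TypedC Γ (.pi A B) (.sort (max i j))
  | lam {Γ A B t i} : TypedC Γ (.pi A B) (.sort i) → TypedC (A :: Γ) t B →
      TypedC Γ (.lam A t) (.pi A B)
  | app {Γ t u A B} : TypedC Γ t (.pi A B) → TypedC Γ u A →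
      TypedC Γ (.app t u) (subst u 0 B)
  | cumul {Γ t A B i} : TypedC Γ t A → TypedC Γ B (.sort i) → Cum A B →
      TypedC Γ t B
end

mutual
/-- Cumulative bidirectional inference `Γ ⊢ t ▹ T`. -/
inductive InferC : Ctx → Tm → Tm → Prop
  | sort {Γ i} : InferC Γ (.sort i) (.sort (i + 1))
  | var {Γ n A} : Γ[n]? = some A → InferC Γ (.var n) (lift (n + 1) 0 A)
  | pi {Γ A B i j} : InferSortC Γ A (.sort i) → InferSortC (A :: Γ) B (.sort j) →
      InferC Γ (.pi A B) (.sort (max i j))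
  | lam {Γ A t B i} : InferSortC Γ A (.sort i) → InferC (A :: Γ) t B →
      InferC Γ (.lam A t) (.pi A B)
  | app {Γ t u A B} : InferPiC Γ t (.pi A B) → CheckC Γ u A →
      InferC Γ (.app t u) (subst u 0 B)

/-- Cumulative bidirectional checking `Γ ⊢ t ◃ T`, using cumulativity. -/
inductive CheckC : Ctx → Tm → Tm → Prop
  | check {Γ t T T'} : InferC Γ t T' → Cum T' T → CheckC Γ t T

/-- Cumulative constrained inference `Γ ⊢ t ▹_□ T` (unchanged: uses reduction). -/
inductive InferSortC : Ctx → Tm → Tm → Prop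
  | inferSort {Γ t T i} : InferC Γ t T → Reds T (.sort i) → InferSortC Γ t (.sort i)

/-- Cumulative constrained inference `Γ ⊢ t ▹_Π T` (unchanged: uses reduction). -/
inductive InferPiC : Ctx → Tm → Tm → Prop
  | inferPi {Γ t T A B} : InferC Γ t T → Reds T (.pi A B) → InferPiC Γ t (.pi A B)
end

/-! ### Commutation of lifting and substitution -/

theorem lift_lift_merge (t : Tm) {m n i k : ℕ} (h₁ : k ≤ i) (h₂ : i ≤ k + n) :
    lift m i (lift n k t) = lift (m + n) k t := by
  induction t generalizing i k with
  | var x => simp only [lift]; split_ifs <;> simp only [lift] <;> grind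
  | sort => rfl
  | pi A B ihA ihB | lam A B ihA ihB =>
    simp only [lift]; rw [ihA h₁ h₂, ihB (by omega) (by omega)]
  | app t u iht ihu => simp only [lift]; rw [iht h₁ h₂, ihu h₁ h₂]

theorem lift_lift_comm (t : Tm) {m n i k : ℕ} (h : i ≤ k) :
    lift m i (lift n k t) = lift n (m + k) (lift m i t) := by
  induction t generalizing i k with
  | var x => simp only [lift]; split_ifs <;> simp only [lift] <;> grind
  | sort => rfl
  | pi A B ihA ihB | lam A B ihA ihB =>
    simp only [lift]; rw [ihA h, ihB (by omega)]; rfl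
  | app t u iht ihu => simp only [lift]; rw [iht h, ihu h]

theorem subst_lift_cancel (t u : Tm) {n i k : ℕ} (h₁ : k ≤ i) (h₂ : i ≤ k + n) :
    subst u i (lift (n + 1) k t) = lift n k t := by
  induction t generalizing i k with
  | var x => simp only [lift]; split_ifs <;> simp only [subst] <;> grind
  | sort => rfl
  | pi A B ihA ihB | lam A B ihA ihB =>
    simp only [lift, subst]; rw [ihA h₁ h₂, ihB (by omega) (by omega)]
  | app t u iht ihu => simp only [lift, subst]; rw [iht h₁ h₂, ihu h₁ h₂]

theorem lift_subst_of_le (t u : Tm) {n i k : ℕ} (h : k ≤ i) :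
    lift n k (subst u i t) = subst u (n + i) (lift n k t) := by
  induction t generalizing i k with
  | var x =>
    rcases lt_trichotomy x i with hx | rfl | hx
    · simp only [lift, subst, hx, if_true]; split_ifs <;> simp only [subst] <;> grind
    · have : ¬ x < k := by omega
      simp only [lift, subst, this, lt_irrefl, if_true, if_false]
      rw [lift_lift_merge u (Nat.zero_le _) (by omega)]
      simp [add_comm]
    · have h1 : ¬ x < i := by omega
      have h2 : x ≠ i := by omega
      have h3 : ¬ x < k := by omega
      have h4 : ¬ x - 1 < k := by omega
      simp only [lift, subst, h1, h2, h3, h4, if_false]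
      grind
  | sort => rfl
  | pi A B ihA ihB | lam A B ihA ihB =>
    simp only [lift, subst]; rw [ihA h, ihB (by omega)]; rfl
  | app t u iht ihu => simp only [lift, subst]; rw [iht h, ihu h]

theorem lift_subst (t u : Tm) (n p k : ℕ) :
    lift n (p + k) (subst u p t) = subst (lift n k u) p (lift n (p + k + 1) t) := by
  induction t generalizing p with
  | var x =>
    rcases lt_trichotomy x p with hx | rfl | hx
    · have h1 : x < p + k := by omega
      have h2 : x < p + k + 1 := by omega
      simp only [lift, subst, hx, h1, h2, if_true]
    · have h1 : x < x + k + 1 := by omega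
      simp only [lift, subst, h1, lt_irrefl, if_true, if_false]
      rw [lift_lift_comm u (Nat.zero_le _)]
    · have h1 : ¬ x < p := by omega
      have h2 : x ≠ p := by omega
      simp only [lift, subst, h1, h2, if_false]
      split_ifs <;> simp only [subst] <;> grind
  | sort => rfl
  | pi A B ihA ihB | lam A B ihA ihB =>
    simp only [lift, subst]
    have := ihB (p + 1)
    rw [show p + 1 + k = p + k + 1 by omega] at this
    rw [ihA, this]
  | app t u iht ihu => simp only [lift, subst]; rw [iht, ihu]

theorem subst_subst (t v w : Tm) (p n : ℕ) :
    subst w (p + n) (subst v p t) = subst (subst w n v) p (subst w (p + n + 1) t) := by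
  induction t generalizing p with
  | var x =>
    rcases lt_trichotomy x p with hx | rfl | hx
    · have h1 : x < p + n := by omega
      have h2 : x < p + n + 1 := by omega
      simp only [subst, hx, h1, h2, if_true]
    · have h1 : x < x + n + 1 := by omega
      simp only [subst, h1, lt_irrefl, if_true, if_false]
      rw [lift_subst_of_le v w (Nat.zero_le _)]
    · have h1 : ¬ x < p := by omega
      have h2 : x ≠ p := by omega
      rcases lt_trichotomy x (p + n + 1) with hy | rfl | hy
      · have h3 : x - 1 < p + n := by omega
        simp only [subst, h1, h2, hy, h3, if_true, if_false]
      · simp only [subst, h1, h2, lt_irrefl, if_true, if_false, Nat.add_sub_cancel]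
        rw [subst_lift_cancel w _ (Nat.zero_le _) (by omega)]
      · have h3 : ¬ x < p + n + 1 := by omega
        have h4 : x ≠ p + n + 1 := by omega
        have h5 : ¬ x - 1 < p + n := by omega
        have h6 : x - 1 ≠ p + n := by omega
        have h7 : ¬ x - 1 < p := by omega
        have h8 : x - 1 ≠ p := by omega
        simp only [subst, h1, h2, h3, h4, h5, h6, h7, h8, if_false]
  | sort => rfl
  | pi A B ihA ihB | lam A B ihA ihB =>
    simp only [subst]
    have := ihB (p + 1)
    rw [show p + 1 + n = p + n + 1 by omega] at this
    rw [ihA, this]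
  | app t u iht ihu => simp only [subst]; rw [iht, ihu]

/-! ### Parallel reduction and confluence -/

/-- Parallel reduction: contract any set of the redexes present in a term. -/
inductive Par : Tm → Tm → Prop
  | var (i : ℕ) : Par (.var i) (.var i)
  | sort (i : ℕ) : Par (.sort i) (.sort i)
  | pi {A A' B B'} : Par A A' → Par B B' → Par (.pi A B) (.pi A' B')
  | lam {A A' t t'} : Par A A' → Par t t' → Par (.lam A t) (.lam A' t')
  | app {t t' u u'} : Par t t' → Par u u' → Par (.app t u) (.app t' u')
  | beta (A : Tm) {t t' u u'} : Par t t' → Par u u' →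
      Par (.app (.lam A t) u) (subst u' 0 t')

theorem Par.refl (t : Tm) : Par t t := by
  induction t <;> constructor <;> assumption

theorem Par.lift {t t' : Tm} (h : Par t t') (n k : ℕ) :
    Par (lift n k t) (lift n k t') := by
  induction h generalizing k with
  | var | sort => exact .refl _
  | pi _ _ ihA ihB => exact .pi (ihA _) (ihB _)
  | lam _ _ ihA iht => exact .lam (ihA _) (iht _)
  | app _ _ iht ihu => exact .app (iht _) (ihu _)
  | @beta A t t' u u' _ _ iht ihu =>
    have h := lift_subst t' u' n 0 k
    rw [Nat.zero_add] at h
    rw [h]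
    exact .beta _ (iht _) (ihu _)

theorem Par.subst {t t' u u' : Tm} (h : Par t t') (hu : Par u u') (k : ℕ) :
    Par (subst u k t) (subst u' k t') := by
  induction h generalizing k with
  | var i =>
    simp only [CComega.subst]
    split_ifs
    exacts [.refl _, hu.lift _ _, .refl _]
  | sort => exact .refl _
  | pi _ _ ihA ihB => exact .pi (ihA _) (ihB _)
  | lam _ _ ihA iht => exact .lam (ihA _) (iht _)
  | app _ _ iht ihu => exact .app (iht _) (ihu _)
  | @beta A t t' v v' _ _ iht ihv =>
    have h := subst_subst t' v' u' 0 k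
    rw [Nat.zero_add] at h
    rw [h]
    exact .beta _ (iht _) (ihv _)

/-- Complete development: contract all the redexes present in a term. -/
def develop : Tm → Tm
  | .var i => .var i
  | .sort i => .sort i
  | .pi A B => .pi (develop A) (develop B)
  | .lam A t => .lam (develop A) (develop t)
  | .app (.lam _ t) u => subst (develop u) 0 (develop t)
  | .app t u => .app (develop t) (develop u)

theorem Par.develop {t t' : Tm} (h : Par t t') : Par t' (develop t) := by
  induction h with
  | var | sort => exact .refl _
  | pi _ _ ihA ihB => exact .pi ihA ihB
  | lam _ _ ihA iht => exact .lam ihA iht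
  | @app t t' u u' ht _ iht ihu =>
    cases t with
    | lam A s =>
      cases ht with
      | lam hA hs =>
        cases iht with
        | lam _ ihs => exact .beta _ ihs ihu
    | _ => exact .app iht ihu
  | beta A _ _ iht ihu => exact iht.subst ihu 0

theorem Red.par {t t' : Tm} (h : Red t t') : Par t t' := by
  induction h with
  | beta A t u => exact .beta A (.refl t) (.refl u)
  | piDom B _ ih => exact .pi ih (.refl _)
  | piCod A _ ih => exact .pi (.refl _) ih
  | lamDom t _ ih => exact .lam ih (.refl _)
  | lamBody A _ ih => exact .lam (.refl _) ih
  | appFun u _ ih => exact .app ih (.refl _)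
  | appArg t _ ih => exact .app (.refl _) ih

theorem Par.reds {t t' : Tm} (h : Par t t') : Reds t t' := by
  induction h with
  | var | sort => exact .refl
  | pi _ _ ihA ihB =>
    exact (ihA.lift (Tm.pi · _) fun _ _ => .piDom _).trans
      (ihB.lift (Tm.pi _) fun _ _ => .piCod _)
  | lam _ _ ihA iht =>
    exact (ihA.lift (Tm.lam · _) fun _ _ => .lamDom _).trans
      (iht.lift (Tm.lam _) fun _ _ => .lamBody _)
  | app _ _ iht ihu =>
    exact (iht.lift (Tm.app · _) fun _ _ => .appFun _).trans
      (ihu.lift (Tm.app _) fun _ _ => .appArg _)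
  | beta A _ _ iht ihu =>
    exact ((iht.lift (fun t => Tm.app (.lam A t) _) fun _ _ h => .appFun _ (.lamBody A h)).trans
      (ihu.lift (Tm.app _) fun _ _ => .appArg _)).tail (.beta _ _ _)

theorem reflTransGen_par_eq_reds : Relation.ReflTransGen Par = Reds := by
  funext t u
  refine propext ⟨fun h => ?_, Relation.ReflTransGen.mono (fun _ _ => Red.par) t u⟩
  induction h with
  | refl => exact .refl
  | tail _ h ih => exact ih.trans h.reds

theorem Reds.confluent {t u v : Tm} (hu : Reds t u) (hv : Reds t v) :
    ∃ w, Reds u w ∧ Reds v w := by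
  rw [← reflTransGen_par_eq_reds] at *
  exact Relation.church_rosser
    (fun _ _ _ h₁ h₂ => ⟨_, .single h₁.develop, .single h₂.develop⟩) hu hv

theorem Conv.exists_common_reduct {t u : Tm} (h : Conv t u) :
    ∃ w, Reds t w ∧ Reds u w := by
  induction h with
  | rel _ _ h => exact ⟨_, .single h, .refl⟩
  | refl => exact ⟨_, .refl, .refl⟩
  | symm _ _ _ ih => obtain ⟨w, h₁, h₂⟩ := ih; exact ⟨w, h₂, h₁⟩
  | trans _ _ _ _ _ ih₁ ih₂ =>
    obtain ⟨w₁, h₁, h₂⟩ := ih₁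
    obtain ⟨w₂, h₃, h₄⟩ := ih₂
    obtain ⟨w, h₅, h₆⟩ := h₂.confluent h₃
    exact ⟨w, h₁.trans h₅, h₄.trans h₆⟩

theorem Reds.conv {t u : Tm} (h : Reds t u) : Conv t u := by
  induction h with
  | refl => exact .refl _
  | tail _ h ih => exact ih.trans _ _ _ (.rel _ _ h)

theorem Conv.map {f : Tm → Tm} (hf : ∀ t t', Red t t' → Conv (f t) (f t'))
    {t t' : Tm} (h : Conv t t') : Conv (f t) (f t') := by
  induction h with
  | rel _ _ h => exact hf _ _ h
  | refl => exact .refl _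
  | symm _ _ _ ih => exact ih.symm
  | trans _ _ _ _ _ ih₁ ih₂ => exact ih₁.trans _ _ _ ih₂

theorem Conv.subst {t t' : Tm} (h : Conv t t') (u : Tm) (k : ℕ) :
    Conv (subst u k t) (subst u k t') :=
  h.map fun _ _ hr => (hr.par.subst (.refl u) k).reds.conv

theorem Conv.pi_right (A : Tm) {B B' : Tm} (h : Conv B B') : Conv (.pi A B) (.pi A B') :=
  h.map fun _ _ hr => .rel _ _ (.piCod A hr)

/-! ### Reduction to sorts and products -/

theorem Reds.sort_eq {i : ℕ} {T : Tm} (h : Reds (.sort i) T) : T = .sort i := by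
  induction h with
  | refl => rfl
  | tail _ h ih => subst ih; cases h

theorem Reds.pi_inv {A B T : Tm} (h : Reds (.pi A B) T) :
    ∃ A' B', T = .pi A' B' ∧ Reds A A' ∧ Reds B B' := by
  induction h with
  | refl => exact ⟨A, B, rfl, .refl, .refl⟩
  | tail _ h ih =>
    obtain ⟨A', B', rfl, hA, hB⟩ := ih
    cases h with
    | piDom _ h => exact ⟨_, _, rfl, hA.tail h, hB⟩
    | piCod _ h => exact ⟨_, _, rfl, hA, hB.tail h⟩

theorem Conv.reds_sort {T : Tm} {i : ℕ} (h : Conv T (.sort i)) : Reds T (.sort i) := by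
  obtain ⟨w, h₁, h₂⟩ := h.exists_common_reduct
  exact h₂.sort_eq ▸ h₁

theorem Conv.reds_pi {T A B : Tm} (h : Conv T (.pi A B)) :
    ∃ A' B', Reds T (.pi A' B') ∧ Conv A A' ∧ Conv B B' := by
  obtain ⟨w, h₁, h₂⟩ := h.exists_common_reduct
  obtain ⟨A', B', rfl, hA, hB⟩ := h₂.pi_inv
  exact ⟨A', B', h₁, hA.conv, hB.conv⟩

theorem Typed.exists_infer {Γ : Ctx} {t T : Tm} : Typed Γ t T →
    ∃ T', Infer Γ t T' ∧ Conv T' T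
  | .sort _ => ⟨_, .sort, .refl _⟩
  | .var _ h => ⟨_, .var h, .refl _⟩
  | .pi hA hB => by
    obtain ⟨_, hA, hA'⟩ := hA.exists_infer
    obtain ⟨_, hB, hB'⟩ := hB.exists_infer
    exact ⟨_, .pi (.inferSort hA hA'.reds_sort) (.inferSort hB hB'.reds_sort), .refl _⟩
  | .lam hP ht => by
    obtain ⟨_, hP, _⟩ := hP.exists_infer
    obtain ⟨_, ht, hB⟩ := ht.exists_infer
    cases hP with
    | pi hA _ => exact ⟨_, .lam hA ht, hB.pi_right _⟩
  | .app ht hu => by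
    obtain ⟨_, ht, hP⟩ := ht.exists_infer
    obtain ⟨_, hu, hu'⟩ := hu.exists_infer
    obtain ⟨A', B', hred, hA, hB⟩ := hP.reds_pi
    exact ⟨_, .app (.inferPi ht hred) (.check hu (hu'.trans _ _ _ hA)),
      Conv.subst hB.symm _ 0⟩
  | .conv ht _ hAB => by
    obtain ⟨_, ht, hA⟩ := ht.exists_infer
    exact ⟨_, ht, hA.trans _ _ _ hAB⟩

/-- **Completeness of bidirectional typing.** If `Γ ⊢ t : T` then there is
`T'` with `Γ ⊢ t ▹ T'` and `T' ≡ T`. -/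
theorem completeness {Γ : Ctx} {t T : Tm} (h : Typed Γ t T) :
    ∃ T', Infer Γ t T' ∧ Conv T' T :=
  h.exists_infer

end CComega
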